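/- arXiv:2303.03782 — 6 statements merged into one kernel-verified Lean document; each statement's English description precedes it below -/
import Mathlib

section
/- Let θ > 0 and α ∈ (−θ, 1). If f : [1,∞) → [0,1] is measurable with sup_{s≥1} s^α |f(s)| < ∞, then T(f) also takes values in [0,1] and satisfies sup_{s≥1} s^α |T(f)(s)| < ∞; i.e., the space F_α is stable under T. -/
open MeasureTheory Real Set

/-- The operator `T` from the integral equation for crossing probabilities. -/
noncomputable def T (θ : ℝ) (f : ℝ → ℝ) : ℝ → ℝ :=
  fun s => 1 - (1 - 1 / s) ^ θ +
    θ * (s - 1) ^ θ * ∫ t in Ioi (1 : ℝ), (s + t - 1) ^ (-θ - 1) * f t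

/-- The kernel of `T` is integrable for every `s ≥ 1`. -/
lemma integrableOn_kernel {θ s : ℝ} (hθ : 0 < θ) (hs : 1 ≤ s) :
    IntegrableOn (fun t => (s + t - 1) ^ (-θ - 1)) (Ioi (1 : ℝ)) := by
  have h := integrableOn_add_rpow_Ioi_of_lt (a := -θ - 1) (c := 1) (m := s - 1)
    (by linarith) (by linarith)
  refine h.congr_fun (fun t _ => ?_) measurableSet_Ioi
  ring_nf

lemma integral_kernel {θ s : ℝ} (hθ : 0 < θ) (hs : 1 ≤ s) :
    ∫ t in Ioi (1 : ℝ), (s + t - 1) ^ (-θ - 1) = s ^ (-θ) / θ := by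
  have h := (measurePreserving_add_right (volume : Measure ℝ) (s - 1)).setIntegral_preimage_emb
    (measurableEmbedding_addRight _) (fun x : ℝ => x ^ (-θ - 1)) (Ioi s)
  rw [integral_Ioi_rpow_of_lt (by linarith) (by linarith)] at h
  have hpre : (fun t : ℝ => t + (s - 1)) ⁻¹' Ioi s = Ioi 1 := by
    ext t
    simp only [mem_preimage, mem_Ioi]
    constructor <;> intro <;> linarith
  rw [hpre] at h
  calc ∫ t in Ioi (1 : ℝ), (s + t - 1) ^ (-θ - 1)
      = ∫ t in Ioi (1 : ℝ), (t + (s - 1)) ^ (-θ - 1) := by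
        congr 1; ext t; ring_nf
    _ = s ^ (-θ) / θ := by
        rw [h, sub_add_cancel, neg_div_neg_eq]

lemma integrableOn_kernel_mul {θ s : ℝ} (hθ : 0 < θ) (hs : 1 ≤ s) {f : ℝ → ℝ}
    (hf_meas : Measurable f) (hf_mem : ∀ t, 1 ≤ t → f t ∈ Icc (0 : ℝ) 1) :
    IntegrableOn (fun t => (s + t - 1) ^ (-θ - 1) * f t) (Ioi (1 : ℝ)) := by
  refine Integrable.mono' (integrableOn_kernel hθ hs) (by fun_prop) ?_
  refine (ae_restrict_iff' measurableSet_Ioi).2 (.of_forall fun t ht => ?_)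
  rw [mem_Ioi] at ht
  have hk : 0 ≤ (s + t - 1) ^ (-θ - 1) := rpow_nonneg (by linarith) _
  obtain ⟨h0, h1⟩ := hf_mem t ht.le
  rw [norm_of_nonneg (mul_nonneg hk h0)]
  exact mul_le_of_le_one_right hk h1

lemma T_mem_Icc {θ : ℝ} (hθ : 0 < θ) {f : ℝ → ℝ} (hf_meas : Measurable f)
    (hf_mem : ∀ t, 1 ≤ t → f t ∈ Icc (0 : ℝ) 1) {s : ℝ} (hs : 1 ≤ s) :
    T θ f s ∈ Icc (0 : ℝ) 1 := by
  have hs0 : 0 < s := by linarith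
  have hsub : 0 ≤ 1 - 1 / s := by rw [sub_nonneg, div_le_one hs0]; exact hs
  have hpow : (1 - 1 / s) ^ θ ≤ 1 :=
    rpow_le_one hsub (by have := one_div_pos.2 hs0; linarith) hθ.le
  have hI0 : 0 ≤ ∫ t in Ioi (1 : ℝ), (s + t - 1) ^ (-θ - 1) * f t :=
    setIntegral_nonneg measurableSet_Ioi fun t ht =>
      mul_nonneg (rpow_nonneg (by rw [mem_Ioi] at ht; linarith) _)
        (hf_mem t (le_of_lt ht)).1
  have hI1 : ∫ t in Ioi (1 : ℝ), (s + t - 1) ^ (-θ - 1) * f t ≤ s ^ (-θ) / θ := by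
    rw [← integral_kernel hθ hs]
    exact setIntegral_mono_on (integrableOn_kernel_mul hθ hs hf_meas hf_mem)
      (integrableOn_kernel hθ hs) measurableSet_Ioi fun t ht =>
      mul_le_of_le_one_right (rpow_nonneg (by rw [mem_Ioi] at ht; linarith) _)
        (hf_mem t (le_of_lt ht)).2
  have hc : 0 ≤ θ * (s - 1) ^ θ := mul_nonneg hθ.le (rpow_nonneg (by linarith) _)
  have hprod : θ * (s - 1) ^ θ * (s ^ (-θ) / θ) = (1 - 1 / s) ^ θ := by
    rw [show 1 - 1 / s = (s - 1) / s by field_simp,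
      div_rpow (by linarith) hs0.le, rpow_neg hs0.le]
    field_simp
  have h := mul_le_mul_of_nonneg_left hI1 hc
  rw [hprod] at h
  have h' := mul_nonneg hc hI0
  constructor <;> simp only [T] <;> linarith

/-- Splitting the integral at `t = s` gives the decay rate `s ^ (-θ - α)`. -/
lemma integral_kernel_mul_le {θ α C s : ℝ} (hθ : 0 < θ) (hα0 : 0 ≤ α) (hα1 : α < 1)
    (hC : 0 ≤ C) (hs : 1 ≤ s) {f : ℝ → ℝ} (hf_meas : Measurable f)
    (hf_mem : ∀ t, 1 ≤ t → f t ∈ Icc (0 : ℝ) 1) (hf : ∀ t, 1 ≤ t → f t ≤ C * t ^ (-α)) :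
    ∫ t in Ioi (1 : ℝ), (s + t - 1) ^ (-θ - 1) * f t ≤
      C * (1 / (1 - α) + 1 / θ) * s ^ (-θ - α) := by
  have hs0 : 0 < s := by linarith
  have hα1' : 0 < 1 - α := by linarith
  have hint := integrableOn_kernel_mul hθ hs hf_meas hf_mem
  have hker := integrableOn_kernel hθ hs
  have hsub : Ioi s ⊆ Ioi (1 : ℝ) := Ioi_subset_Ioi hs
  have hrpow : IntegrableOn (fun t : ℝ => t ^ (-α)) (Ioc 1 s) :=
    (intervalIntegral.intervalIntegrable_rpow' (by linarith)).1
  have hsplit : ∫ t in Ioi (1 : ℝ), (s + t - 1) ^ (-θ - 1) * f t =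
      (∫ t in Ioc 1 s, (s + t - 1) ^ (-θ - 1) * f t) +
        ∫ t in Ioi s, (s + t - 1) ^ (-θ - 1) * f t := by
    rw [← setIntegral_union Ioc_disjoint_Ioi_same measurableSet_Ioi
      (hint.mono_set Ioc_subset_Ioi_self) (hint.mono_set hsub), Ioc_union_Ioi_eq_Ioi hs]
  have hnear : ∫ t in Ioc 1 s, (s + t - 1) ^ (-θ - 1) * f t ≤
      C * s ^ (-θ - 1) * (s ^ (1 - α) / (1 - α)) := by
    calc ∫ t in Ioc 1 s, (s + t - 1) ^ (-θ - 1) * f t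
        ≤ ∫ t in Ioc 1 s, C * s ^ (-θ - 1) * t ^ (-α) := by
          refine setIntegral_mono_on (hint.mono_set Ioc_subset_Ioi_self)
            (hrpow.const_mul _) measurableSet_Ioc fun t ht => ?_
          have h1 : (s + t - 1) ^ (-θ - 1) ≤ s ^ (-θ - 1) :=
            rpow_le_rpow_of_nonpos hs0 (by linarith [ht.1]) (by linarith)
          calc _ ≤ s ^ (-θ - 1) * (C * t ^ (-α)) :=
                mul_le_mul h1 (hf t ht.1.le) (hf_mem t ht.1.le).1 (rpow_nonneg hs0.le _)
            _ = _ := by ring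
      _ ≤ C * s ^ (-θ - 1) * (s ^ (1 - α) / (1 - α)) := by
          rw [integral_const_mul, ← intervalIntegral.integral_of_le hs,
            integral_rpow (Or.inl (by linarith)), one_rpow, neg_add_eq_sub]
          gcongr
          linarith
  have hfar : ∫ t in Ioi s, (s + t - 1) ^ (-θ - 1) * f t ≤ C * s ^ (-α) * (s ^ (-θ) / θ) := by
    calc ∫ t in Ioi s, (s + t - 1) ^ (-θ - 1) * f t
        ≤ ∫ t in Ioi s, C * s ^ (-α) * (s + t - 1) ^ (-θ - 1) := by
          refine setIntegral_mono_on (hint.mono_set hsub)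
            ((hker.mono_set hsub).const_mul _) measurableSet_Ioi fun t ht => ?_
          rw [mem_Ioi] at ht
          have h1 : t ^ (-α) ≤ s ^ (-α) := rpow_le_rpow_of_nonpos hs0 ht.le (by linarith)
          have h2 : f t ≤ C * s ^ (-α) :=
            (hf t (by linarith)).trans (mul_le_mul_of_nonneg_left h1 hC)
          rw [mul_comm]
          exact mul_le_mul_of_nonneg_right h2 (rpow_nonneg (by linarith) _)
      _ ≤ C * s ^ (-α) * (s ^ (-θ) / θ) := by
          rw [integral_const_mul, ← integral_kernel hθ hs]
          refine mul_le_mul_of_nonneg_left (setIntegral_mono_set hker ?_ hsub.eventuallyLE)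
            (by positivity)
          refine (ae_restrict_iff' measurableSet_Ioi).2 (.of_forall fun t ht => ?_)
          rw [mem_Ioi] at ht
          exact rpow_nonneg (by linarith) _
  have e1 : s ^ (-θ - 1) * s ^ (1 - α) = s ^ (-θ - α) := by
    rw [← rpow_add hs0]; ring_nf
  have e2 : s ^ (-α) * s ^ (-θ) = s ^ (-θ - α) := by
    rw [← rpow_add hs0]; ring_nf
  calc _ ≤ C * s ^ (-θ - 1) * (s ^ (1 - α) / (1 - α)) + C * s ^ (-α) * (s ^ (-θ) / θ) := by
        rw [hsplit]; exact add_le_add hnear hfar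
    _ = C / (1 - α) * (s ^ (-θ - 1) * s ^ (1 - α)) + C / θ * (s ^ (-α) * s ^ (-θ)) := by ring
    _ = _ := by rw [e1, e2]; ring

lemma one_sub_one_sub_rpow_le {θ x : ℝ} (hθ : 0 < θ) (hx0 : 0 ≤ x) (hx1 : x ≤ 1) :
    1 - (1 - x) ^ θ ≤ max 1 θ * x := by
  rcases le_total 1 θ with h | h
  · have hb := one_add_mul_self_le_rpow_one_add (s := -x) (by linarith) h
    rw [← sub_eq_add_neg] at hb
    rw [max_eq_right h]
    linarith
  · have hb := rpow_le_rpow_of_exponent_ge' (x := 1 - x) (by linarith) (by linarith) hθ.le h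
    rw [rpow_one] at hb
    rw [max_eq_left h]
    linarith

/-- For `θ > 0` and `α ∈ (−θ, 1)`, the space `F_α` of measurable
functions `f : [1,∞) → [0,1]` with `sup_{s ≥ 1} s^α |f s| < ∞` is stable under `T`:
`T f` also takes values in `[0,1]` on `[1,∞)` and has finite `α`-norm. -/
theorem F_alpha_stable_under_T (θ α : ℝ) (hθ : 0 < θ) (hα : α ∈ Ioo (-θ) 1)
    (f : ℝ → ℝ) (hf_meas : Measurable f)
    (hf_mem : ∀ s, 1 ≤ s → f s ∈ Icc (0 : ℝ) 1)
    (hf_norm : BddAbove ((fun s => s ^ α * |f s|) '' Ici 1)) :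
    (∀ s, 1 ≤ s → T θ f s ∈ Icc (0 : ℝ) 1) ∧
      BddAbove ((fun s => s ^ α * |T θ f s|) '' Ici 1) := by
  have hT : ∀ s, 1 ≤ s → T θ f s ∈ Icc (0 : ℝ) 1 := fun s hs => T_mem_Icc hθ hf_meas hf_mem hs
  refine ⟨hT, ?_⟩
  rcases le_total α 0 with hα0 | hα0
  · refine ⟨1, ?_⟩
    rintro _ ⟨s, hs, rfl⟩
    obtain ⟨h0, h1⟩ := hT s hs
    simp only [abs_of_nonneg h0]
    exact mul_le_one₀ (rpow_le_one_of_one_le_of_nonpos hs hα0) h0 h1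
  obtain ⟨C, hC⟩ := hf_norm
  have hfC : ∀ t, 1 ≤ t → f t ≤ C * t ^ (-α) := fun t ht => by
    have h : t ^ α * |f t| ≤ C := hC ⟨t, ht, rfl⟩
    rw [abs_of_nonneg (hf_mem t ht).1] at h
    have ht0 : 0 < t := by linarith
    rw [rpow_neg ht0.le, ← div_eq_mul_inv, le_div_iff₀ (rpow_pos_of_pos ht0 _), mul_comm]
    exact h
  have hC0 : 0 ≤ C := by
    have h := (hf_mem 1 le_rfl).1.trans (hfC 1 le_rfl)
    rwa [one_rpow, mul_one] at h
  refine ⟨max 1 θ + θ * (C * (1 / (1 - α) + 1 / θ)), ?_⟩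
  rintro _ ⟨s, hs, rfl⟩
  rw [mem_Ici] at hs
  have hs0 : 0 < s := by linarith
  have hα1 : 0 < 1 - α := by linarith [hα.2]
  have hK : 0 ≤ C * (1 / (1 - α) + 1 / θ) := by positivity
  have hfirst : s ^ α * (1 - (1 - 1 / s) ^ θ) ≤ max 1 θ := by
    have hx : 1 / s ≤ 1 := (div_le_one hs0).2 hs
    have h1 := one_sub_one_sub_rpow_le hθ (one_div_nonneg.2 hs0.le) hx
    have h2 : s ^ α * (1 / s) ≤ 1 := by
      rw [mul_one_div, div_le_one hs0]
      simpa using rpow_le_rpow_of_exponent_le hs hα.2.le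
    calc _ ≤ s ^ α * (max 1 θ * (1 / s)) := by gcongr
      _ = max 1 θ * (s ^ α * (1 / s)) := by ring
      _ ≤ max 1 θ := mul_le_of_le_one_right (by positivity) h2
  have hsecond : s ^ α * (θ * (s - 1) ^ θ *
      ∫ t in Ioi (1 : ℝ), (s + t - 1) ^ (-θ - 1) * f t) ≤
        θ * (C * (1 / (1 - α) + 1 / θ)) := by
    have hI := integral_kernel_mul_le hθ hα0 hα.2 hC0 hs hf_meas hf_mem hfC
    have hs1 : 0 ≤ s - 1 := by linarith
    have hpow : (s - 1) ^ θ ≤ s ^ θ := rpow_le_rpow hs1 (by linarith) hθ.le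
    have hone : s ^ α * s ^ θ * s ^ (-θ - α) = 1 := by
      rw [← rpow_add hs0, ← rpow_add hs0, show α + θ + (-θ - α) = 0 by ring, rpow_zero]
    calc _ ≤ s ^ α * (θ * (s - 1) ^ θ * (C * (1 / (1 - α) + 1 / θ) * s ^ (-θ - α))) := by
          gcongr
      _ ≤ s ^ α * (θ * s ^ θ * (C * (1 / (1 - α) + 1 / θ) * s ^ (-θ - α))) := by
          gcongr
      _ = θ * (C * (1 / (1 - α) + 1 / θ)) * (s ^ α * s ^ θ * s ^ (-θ - α)) := by ring
      _ = _ := by rw [hone, mul_one]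
  simp only [abs_of_nonneg (hT s hs).1]
  simp only [T, mul_add]
  simp only [mul_add] at hsecond
  linarith
end

section
/- Let θ > 0 and α ∈ (−θ, 1). Then lim_{s→∞} s^α · (θ/(s−1)) · ∫_1^∞ (1 + t/(s−1))^{−θ−1} t^{−α} dt = Γ(1−α)Γ(α+θ)/Γ(θ). -/
open MeasureTheory Real Set Filter

lemma ofReal_rpow_mul_one_sub_rpow (a b : ℝ) {x : ℝ} (hx : x ∈ Ioo (0 : ℝ) 1) :
    ((x ^ (a - 1) * (1 - x) ^ (b - 1) : ℝ) : ℂ) =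
      (x : ℂ) ^ ((a : ℂ) - 1) * (1 - (x : ℂ)) ^ ((b : ℂ) - 1) := by
  rw [Complex.ofReal_mul, Complex.ofReal_cpow hx.1.le, Complex.ofReal_cpow (sub_pos.2 hx.2).le]
  push_cast
  rfl

lemma integrableOn_rpow_mul_one_sub_rpow {a b : ℝ} (ha : 0 < a) (hb : 0 < b) :
    IntegrableOn (fun x : ℝ => x ^ (a - 1) * (1 - x) ^ (b - 1)) (Ioo 0 1) := by
  have h := Complex.betaIntegral_convergent (u := a) (v := b) (by simpa) (by simpa)
  rw [intervalIntegrable_iff_integrableOn_Ioo_of_le zero_le_one] at h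
  refine IntegrableOn.congr_fun h.re (fun x hx => ?_) measurableSet_Ioo
  simp only [← ofReal_rpow_mul_one_sub_rpow a b hx]
  exact Complex.ofReal_re _

lemma integral_rpow_mul_one_sub_rpow {a b : ℝ} (ha : 0 < a) (hb : 0 < b) :
    ∫ x in Ioo (0 : ℝ) 1, x ^ (a - 1) * (1 - x) ^ (b - 1) =
      Gamma a * Gamma b / Gamma (a + b) := by
  have h := ProbabilityTheory.beta_eq_betaIntegralReal a b ha hb
  rw [ProbabilityTheory.beta, Complex.betaIntegral,
    intervalIntegral.integral_of_le zero_le_one, integral_Ioc_eq_integral_Ioo,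
    ← setIntegral_congr_fun measurableSet_Ioo
      (fun x hx => ofReal_rpow_mul_one_sub_rpow a b hx), integral_complex_ofReal,
    Complex.ofReal_re] at h
  exact h.symm

lemma image_div_one_add_Ioi : (fun u : ℝ => u / (1 + u)) '' Ioi 0 = Ioo 0 1 := by
  ext x
  constructor
  · rintro ⟨u, hu, rfl⟩
    have hu : 0 < u := hu
    exact ⟨by positivity, (div_lt_one (by positivity)).2 (by linarith)⟩
  · rintro ⟨h0, h1⟩
    have : 0 < 1 - x := sub_pos.2 h1
    refine ⟨x / (1 - x), div_pos h0 this, ?_⟩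
    simp only
    field_simp
    ring

lemma injOn_div_one_add_Ioi : InjOn (fun u : ℝ => u / (1 + u)) (Ioi 0) := by
  intro u hu v hv h
  have hu : 0 < u := hu
  have hv : 0 < v := hv
  simp only at h
  rw [div_eq_div_iff (by positivity) (by positivity)] at h
  linarith

lemma hasDerivWithinAt_div_one_add {u : ℝ} (hu : u ∈ Ioi (0 : ℝ)) :
    HasDerivWithinAt (fun u : ℝ => u / (1 + u)) (1 / (1 + u) ^ 2) (Ioi 0) u := by
  have hu : 0 < u := hu
  have h := (hasDerivAt_id u).div ((hasDerivAt_id u).const_add 1) (by simp; positivity)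
  refine (h.congr_deriv ?_).hasDerivWithinAt
  simp

lemma abs_deriv_smul_beta_integrand (a b : ℝ) {u : ℝ} (hu : u ∈ Ioi (0 : ℝ)) :
    |1 / (1 + u) ^ 2| • ((u / (1 + u)) ^ (a - 1) * (1 - u / (1 + u)) ^ (b - 1)) =
      (1 + u) ^ (-(a + b)) * u ^ (a - 1) := by
  have hu : 0 < u := hu
  have h1 : 0 < 1 + u := by positivity
  have h2 : 1 - u / (1 + u) = (1 + u)⁻¹ := by field_simp; ring
  have h3 : 1 / (1 + u) ^ 2 = (1 + u) ^ (-2 : ℝ) := by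
    rw [rpow_neg h1.le, one_div]; norm_cast
  have h4 : (1 + u) ^ (-(a + b)) =
      (1 + u) ^ (-2 : ℝ) * (1 + u) ^ (-(a - 1)) * (1 + u) ^ (-(b - 1)) := by
    rw [← rpow_add h1, ← rpow_add h1]; congr 1; ring
  rw [abs_of_pos (by positivity), smul_eq_mul, h2, h3, h4, div_rpow hu.le h1.le,
    inv_rpow h1.le, rpow_neg h1.le (a - 1), rpow_neg h1.le (b - 1)]
  ring

lemma integrableOn_one_add_rpow_mul_rpow {a b : ℝ} (ha : 0 < a) (hb : 0 < b) :
    IntegrableOn (fun u : ℝ => (1 + u) ^ (-(a + b)) * u ^ (a - 1)) (Ioi 0) := by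
  have h := integrableOn_rpow_mul_one_sub_rpow ha hb
  rw [← image_div_one_add_Ioi, integrableOn_image_iff_integrableOn_abs_deriv_smul
    measurableSet_Ioi (fun u hu => hasDerivWithinAt_div_one_add hu) injOn_div_one_add_Ioi] at h
  exact h.congr_fun (fun u hu => abs_deriv_smul_beta_integrand a b hu) measurableSet_Ioi

lemma integral_one_add_rpow_mul_rpow {a b : ℝ} (ha : 0 < a) (hb : 0 < b) :
    ∫ u in Ioi (0 : ℝ), (1 + u) ^ (-(a + b)) * u ^ (a - 1) =
      Gamma a * Gamma b / Gamma (a + b) := by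
  rw [← integral_rpow_mul_one_sub_rpow ha hb, ← image_div_one_add_Ioi,
    integral_image_eq_integral_abs_deriv_smul measurableSet_Ioi
      (fun u hu => hasDerivWithinAt_div_one_add hu) injOn_div_one_add_Ioi]
  exact (setIntegral_congr_fun measurableSet_Ioi
    (fun u hu => abs_deriv_smul_beta_integrand a b hu)).symm

lemma tendsto_setIntegral_Ioi_inv {f : ℝ → ℝ} (hf : IntegrableOn f (Ioi 0)) :
    Tendsto (fun r : ℝ => ∫ u in Ioi r⁻¹, f u) atTop (nhds (∫ u in Ioi (0 : ℝ), f u)) := by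
  have h := (aecover_Ioi_of_Ioi (μ := volume)
    (tendsto_inv_atTop_zero (𝕜 := ℝ))).integral_tendsto_of_countably_generated hf
  refine h.congr' ?_
  filter_upwards [eventually_gt_atTop 0] with r hr
  rw [Measure.restrict_restrict measurableSet_Ioi,
    inter_eq_left.2 (Ioi_subset_Ioi (inv_pos.2 hr).le)]

lemma integral_Ioi_one_scaled (c α : ℝ) {r : ℝ} (hr : 0 < r) :
    ∫ t in Ioi (1 : ℝ), (1 + t / r) ^ c * t ^ (-α) =
      r ^ (1 - α) * ∫ u in Ioi r⁻¹, (1 + u) ^ c * u ^ (-α) := by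
  have h := integral_comp_mul_left_Ioi (fun t : ℝ => (1 + t / r) ^ c * t ^ (-α)) r⁻¹ hr
  rw [mul_inv_cancel₀ hr.ne', smul_eq_mul, inv_mul_eq_div, eq_div_iff hr.ne'] at h
  rw [← h, show (1 - α) = -α + 1 by ring, rpow_add_one hr.ne', mul_comm, mul_comm (r ^ (-α)),
    mul_assoc, ← integral_const_mul (r ^ (-α))]
  congr 1
  refine setIntegral_congr_fun measurableSet_Ioi fun u hu => ?_
  have hu : 0 < u := (inv_pos.2 hr).trans hu
  simp only [mul_div_cancel_left₀ u hr.ne', mul_rpow hr.le hu.le]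
  ring

/-- For `θ > 0` and `α ∈ (−θ, 1)`,
`s^α (θ/(s−1)) ∫_1^∞ (1 + t/(s−1))^{−θ−1} t^{−α} dt → Γ(1−α)Γ(α+θ)/Γ(θ)` as `s → ∞`. -/
theorem limit_is_c_alpha_theta (θ α : ℝ) (hθ : 0 < θ) (hα : α ∈ Ioo (-θ) 1) :
    Tendsto
      (fun s : ℝ => s ^ α * (θ / (s - 1)) *
        ∫ t in Ioi (1 : ℝ), (1 + t / (s - 1)) ^ (-θ - 1) * t ^ (-α))
      atTop
      (nhds (Real.Gamma (1 - α) * Real.Gamma (α + θ) / Real.Gamma θ)) := by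
  have ha : 0 < 1 - α := sub_pos.2 hα.2
  have hb : 0 < α + θ := by linarith [hα.1]
  have hint := integrableOn_one_add_rpow_mul_rpow ha hb
  have hval := integral_one_add_rpow_mul_rpow ha hb
  rw [show -(1 - α + (α + θ)) = -θ - 1 by ring, show 1 - α - 1 = -α by ring] at hint hval
  rw [show 1 - α + (α + θ) = θ + 1 by ring, Gamma_add_one hθ.ne'] at hval
  have hshift : Tendsto (fun s : ℝ => s - 1) atTop atTop :=
    tendsto_atTop_add_const_right _ (-1) tendsto_id
  have hI := (tendsto_setIntegral_Ioi_inv hint).comp hshift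
  rw [hval] at hI
  have hratio : Tendsto (fun s : ℝ => (1 + (s - 1)⁻¹) ^ α) atTop (nhds 1) := by
    have h := (tendsto_inv_atTop_zero.comp hshift).const_add (1 : ℝ)
    rw [add_zero] at h
    simpa using h.rpow_const (p := α) (Or.inl one_ne_zero)
  have hlim := (hratio.mul_const θ).mul hI
  have hΓ := (Gamma_pos_of_pos hθ).ne'
  rw [show 1 * θ * (Gamma (1 - α) * Gamma (α + θ) / (θ * Gamma θ)) =
    Gamma (1 - α) * Gamma (α + θ) / Gamma θ by field_simp] at hlim
  refine hlim.congr' ?_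
  filter_upwards [eventually_gt_atTop 1] with s hs
  have hr : 0 < s - 1 := sub_pos.2 hs
  have hs0 : 0 < s := by linarith
  rw [integral_Ioi_one_scaled _ _ hr, show 1 + (s - 1)⁻¹ = s / (s - 1) by field_simp; ring,
    div_rpow hs0.le hr.le, rpow_sub hr, rpow_one]
  simp only [Function.comp_apply]
  have := (rpow_pos_of_pos hr α).ne'
  field_simp
end

section
/- Let θ > 0 and α ∈ (−θ, 1). The function s ↦ s^α · (θ/(s−1)) · ∫_1^∞ (1 + t/(s−1))^{−θ−1} t^{−α} dt is monotonically increasing on (1,∞) and is bounded above by c(α,θ) = Γ(1−α)Γ(α+θ)/Γ(θ); consequently its supremum over s > 1 equals c(α,θ). -/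
open MeasureTheory Real Set

lemma ofReal_betaIntegrand (u v : ℝ) {x : ℝ} (hx : x ∈ Ioc (0 : ℝ) 1) :
    (x : ℂ) ^ ((u : ℂ) - 1) * (1 - (x : ℂ)) ^ ((v : ℂ) - 1) =
      ((x ^ (u - 1) * (1 - x) ^ (v - 1) : ℝ) : ℂ) := by
  rw [Complex.ofReal_mul, Complex.ofReal_cpow hx.1.le, Complex.ofReal_cpow (sub_nonneg.2 hx.2)]
  push_cast
  rfl

lemma intervalIntegrable_betaIntegrand {u v : ℝ} (hu : 0 < u) (hv : 0 < v) :
    IntervalIntegrable (fun x : ℝ => x ^ (u - 1) * (1 - x) ^ (v - 1)) volume 0 1 := by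
  have h := (Complex.betaIntegral_convergent (u := u) (v := v) (by simpa) (by simpa)).1.re
  rw [intervalIntegrable_iff_integrableOn_Ioc_of_le zero_le_one]
  refine IntegrableOn.congr_fun h (fun x hx => ?_) measurableSet_Ioc
  simp only [ofReal_betaIntegrand u v hx]
  exact RCLike.ofReal_re (K := ℂ) _

lemma integral_betaIntegrand {u v : ℝ} (hu : 0 < u) (hv : 0 < v) :
    ∫ x in (0 : ℝ)..1, x ^ (u - 1) * (1 - x) ^ (v - 1) =
      Real.Gamma u * Real.Gamma v / Real.Gamma (u + v) := by
  change _ = ProbabilityTheory.beta u v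
  rw [ProbabilityTheory.beta_eq_betaIntegralReal u v hu hv, Complex.betaIntegral,
    intervalIntegral.integral_congr_ae (g := fun x : ℝ =>
      ((x ^ (u - 1) * (1 - x) ^ (v - 1) : ℝ) : ℂ)), intervalIntegral.integral_ofReal,
    Complex.ofReal_re]
  refine Filter.Eventually.of_forall fun x hx => ofReal_betaIntegrand u v ?_
  rwa [uIoc_of_le zero_le_one] at hx

/-- The incomplete beta integral, rescaled to `[0, 1]`. -/
lemma integral_betaIntegrand_eq_rpow_mul (u v : ℝ) {a : ℝ} (ha : 0 < a) :
    ∫ x in (0 : ℝ)..a, x ^ (u - 1) * (1 - x) ^ (v - 1) =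
      a ^ u * ∫ x in (0 : ℝ)..1, x ^ (u - 1) * (1 - a * x) ^ (v - 1) := by
  have h := intervalIntegral.smul_integral_comp_mul_left (a := 0) (b := 1)
    (fun x : ℝ => x ^ (u - 1) * (1 - x) ^ (v - 1)) a
  rw [mul_zero, mul_one] at h
  rw [← h, smul_eq_mul, ← intervalIntegral.integral_const_mul,
    ← intervalIntegral.integral_const_mul]
  refine intervalIntegral.integral_congr fun x hx => ?_
  rw [uIcc_of_le zero_le_one] at hx
  have h1 : a ^ u = a ^ (u - 1) * a := by rw [← rpow_add_one ha.ne', sub_add_cancel]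
  simp only [mul_rpow ha.le hx.1, h1]
  ring

lemma monotoneOn_rpow_mul_integral_betaIntegrand {u v : ℝ} (hu : 0 < u) (hv : 0 < v)
    (huv : 0 < u + v - 1) :
    MonotoneOn (fun a : ℝ => a ^ (v - 1) * ∫ x in (0 : ℝ)..a, x ^ (u - 1) * (1 - x) ^ (v - 1))
      (Ioc 0 1) := by
  intro a ha b hb hab
  have hint : ∀ c ∈ Ioc (0 : ℝ) 1,
      IntervalIntegrable (fun x : ℝ => x ^ (u - 1) * (1 - x) ^ (v - 1)) volume 0 c := by
    intro c hc
    refine (intervalIntegrable_betaIntegrand hu hv).mono_set ?_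
    rw [uIcc_of_le hc.1.le, uIcc_of_le zero_le_one]
    exact Icc_subset_Icc_right hc.2
  rcases le_total 1 v with h | h
  · have hnn : ∀ x ∈ Ioc (0 : ℝ) 1, 0 ≤ x ^ (u - 1) * (1 - x) ^ (v - 1) := fun x hx =>
      mul_nonneg (rpow_nonneg hx.1.le _) (rpow_nonneg (sub_nonneg.2 hx.2) _)
    refine mul_le_mul (rpow_le_rpow ha.1.le hab (by linarith)) ?_ ?_ (rpow_nonneg hb.1.le _)
    · refine intervalIntegral.integral_mono_interval le_rfl ha.1.le hab ?_ (hint b hb)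
      filter_upwards [ae_restrict_mem measurableSet_Ioc] with x hx
      exact hnn x ⟨hx.1, hx.2.trans hb.2⟩
    · rw [intervalIntegral.integral_of_le ha.1.le]
      exact setIntegral_nonneg measurableSet_Ioc fun x hx => hnn x ⟨hx.1, hx.2.trans ha.2⟩
  · have hscaled : ∀ c ∈ Ioc (0 : ℝ) 1,
        IntervalIntegrable (fun x : ℝ => x ^ (u - 1) * (1 - c * x) ^ (v - 1)) volume 0 1 := by
      intro c hc
      have h1 := ((hint c hc).comp_mul_left (c := c)).const_mul (c ^ (u - 1))⁻¹
      rw [zero_div, div_self hc.1.ne'] at h1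
      rw [intervalIntegrable_iff_integrableOn_Ioc_of_le zero_le_one] at h1 ⊢
      refine h1.congr_fun (fun x hx => ?_) measurableSet_Ioc
      have := (rpow_pos_of_pos hc.1 (u - 1)).ne'
      simp only [mul_rpow hc.1.le hx.1.le]
      field_simp
    have hpow : ∀ c ∈ Ioc (0 : ℝ) 1,
        c ^ (v - 1) * ∫ x in (0 : ℝ)..c, x ^ (u - 1) * (1 - x) ^ (v - 1) =
          c ^ (u + v - 1) * ∫ x in (0 : ℝ)..1, x ^ (u - 1) * (1 - c * x) ^ (v - 1) := by
      intro c hc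
      rw [integral_betaIntegrand_eq_rpow_mul u v hc.1, ← mul_assoc, ← rpow_add hc.1]
      ring_nf
    simp only [hpow a ha, hpow b hb]
    refine mul_le_mul (rpow_le_rpow ha.1.le hab huv.le) ?_ ?_ (rpow_nonneg hb.1.le _)
    · refine intervalIntegral.integral_mono_on_of_le_Ioo zero_le_one (hscaled a ha)
        (hscaled b hb) fun x hx => ?_
      refine mul_le_mul_of_nonneg_left ?_ (rpow_nonneg hx.1.le _)
      refine rpow_le_rpow_of_nonpos ?_ ?_ (by linarith)
      · nlinarith [hx.1, hx.2, hb.1, hb.2]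
      · nlinarith [hx.1]
    · rw [intervalIntegral.integral_of_le zero_le_one]
      refine setIntegral_nonneg measurableSet_Ioc fun x hx =>
        mul_nonneg (rpow_nonneg hx.1.le _) (rpow_nonneg ?_ _)
      nlinarith [hx.1, hx.2, ha.1, ha.2]

lemma image_div_add_Ioi_one {m : ℝ} (hm : 0 < m) :
    (fun t : ℝ => m / (m + t)) '' Ioi 1 = Ioo 0 (m / (m + 1)) := by
  ext x
  constructor
  · rintro ⟨t, ht, rfl⟩
    have ht : 1 < t := ht
    exact ⟨by positivity, div_lt_div_of_pos_left hm (by linarith) (by linarith)⟩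
  · rintro ⟨h0, h1⟩
    refine ⟨m / x - m, ?_, ?_⟩
    · have : m + 1 < m / x := by
        rw [lt_div_iff₀ h0]
        rwa [lt_div_iff₀ (by linarith), mul_comm] at h1
      change 1 < m / x - m
      linarith
    · simp only [add_sub_cancel]
      field_simp

/-- The substitution `x = m / (m + t)`. -/
lemma integral_betaIntegrand_eq_integral_Ioi (θ α : ℝ) {m : ℝ} (hm : 0 < m) :
    ∫ x in (0 : ℝ)..(m / (m + 1)), x ^ (α + θ - 1) * (1 - x) ^ (1 - α - 1) =
      m ^ (α - 1) * ∫ t in Ioi (1 : ℝ), (1 + t / m) ^ (-θ - 1) * t ^ (-α) := by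
  have hderiv : ∀ t ∈ Ioi (1 : ℝ),
      HasDerivWithinAt (fun t : ℝ => m / (m + t)) (-m / (m + t) ^ 2) (Ioi 1) t := by
    intro t ht
    have ht : 1 < t := ht
    have h := (hasDerivAt_const t m).fun_div ((hasDerivAt_id t).const_add m)
      (by simp only [id]; linarith)
    simpa using h.hasDerivWithinAt
  have hinj : InjOn (fun t : ℝ => m / (m + t)) (Ioi 1) := by
    intro t ht t' ht' h
    have ht : 1 < t := ht
    have ht' : 1 < t' := ht'
    have h1 : m + t ≠ 0 := by linarith
    have h2 : m + t' ≠ 0 := by linarith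
    simp only [div_eq_div_iff h1 h2] at h
    linarith [mul_left_cancel₀ hm.ne' h]
  rw [intervalIntegral.integral_of_le (by positivity), integral_Ioc_eq_integral_Ioo,
    ← image_div_add_Ioi_one hm,
    integral_image_eq_integral_abs_deriv_smul measurableSet_Ioi hderiv hinj,
    ← integral_const_mul]
  refine setIntegral_congr_fun measurableSet_Ioi fun t ht => ?_
  have ht : 0 < t := zero_lt_one.trans ht
  have hmt : 0 < m + t := by linarith
  have h1 : 1 + t / m = (m / (m + t))⁻¹ := by field_simp
  have h2 : 1 - m / (m + t) = t * (m / (m + t)) * m⁻¹ := by field_simp; ring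
  have h3 : |-m / (m + t) ^ 2| = (m / (m + t)) ^ (2 : ℝ) * m⁻¹ := by
    rw [neg_div, abs_neg, abs_of_pos (by positivity), rpow_two]
    field_simp
  have hy : 0 < m / (m + t) := by positivity
  simp only [smul_eq_mul, h1, h2, h3]
  generalize m / (m + t) = y at hy
  rw [mul_rpow (by positivity) (by positivity), mul_rpow ht.le hy.le, inv_rpow hy.le,
    inv_rpow hm.le, ← rpow_neg hy.le, ← rpow_neg hm.le]
  have e1 : y ^ (-(-θ - 1)) = y ^ (2 : ℝ) * y ^ (α + θ - 1) * y ^ (1 - α - 1) := by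
    rw [← rpow_add hy, ← rpow_add hy]
    ring_nf
  have e2 : m ^ (α - 1) = m⁻¹ * m ^ (-(1 - α - 1)) := by
    rw [← rpow_neg_one, ← rpow_add hm]
    ring_nf
  have e3 : (1 - α - 1) = -α := by ring
  rw [e1, e2, e3]
  ring

lemma rpow_mul_integral_Ioi_eq_integral_betaIntegrand (θ α : ℝ) {s : ℝ} (hs : 1 < s) :
    s ^ α * (θ / (s - 1)) * (∫ t in Ioi (1 : ℝ), (1 + t / (s - 1)) ^ (-θ - 1) * t ^ (-α)) =
      θ * (((s - 1) / s) ^ (1 - α - 1) *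
        ∫ x in (0 : ℝ)..((s - 1) / s), x ^ (α + θ - 1) * (1 - x) ^ (1 - α - 1)) := by
  have hm : 0 < s - 1 := sub_pos.2 hs
  have hs0 : 0 < s := by linarith
  have h := integral_betaIntegrand_eq_integral_Ioi θ α hm
  rw [sub_add_cancel] at h
  have e1 : (1 - α - 1) = -α := by ring
  have e2 : (s - 1) ^ (α - 1) = (s - 1) ^ α * (s - 1)⁻¹ := by
    rw [rpow_sub_one hm.ne', div_eq_mul_inv]
  have h1 := (rpow_pos_of_pos hm α).ne'
  have h2 := (rpow_pos_of_pos hs0 α).ne'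
  rw [h, e1, e2, rpow_neg (by positivity), div_rpow hm.le hs0.le]
  field_simp

/-- For `θ > 0` and `α ∈ (−θ, 1)`, the function
`s ↦ s^α (θ/(s−1)) ∫_1^∞ (1 + t/(s−1))^{−θ−1} t^{−α} dt` is monotonically increasing
on `(1,∞)`, bounded above by `c(α,θ) = Γ(1−α)Γ(α+θ)/Γ(θ)`, and its supremum over
`s > 1` equals `c(α,θ)`. -/
theorem sup_is_c_alpha_theta (θ α : ℝ) (hθ : 0 < θ) (hα : α ∈ Ioo (-θ) 1) :
    MonotoneOn
      (fun s : ℝ => s ^ α * (θ / (s - 1)) *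
        ∫ t in Ioi (1 : ℝ), (1 + t / (s - 1)) ^ (-θ - 1) * t ^ (-α))
      (Ioi 1) ∧
    (∀ s ∈ Ioi (1 : ℝ),
      s ^ α * (θ / (s - 1)) *
          (∫ t in Ioi (1 : ℝ), (1 + t / (s - 1)) ^ (-θ - 1) * t ^ (-α)) ≤
        Real.Gamma (1 - α) * Real.Gamma (α + θ) / Real.Gamma θ) ∧
    sSup ((fun s : ℝ => s ^ α * (θ / (s - 1)) *
        ∫ t in Ioi (1 : ℝ), (1 + t / (s - 1)) ^ (-θ - 1) * t ^ (-α)) '' Ioi 1) =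
      Real.Gamma (1 - α) * Real.Gamma (α + θ) / Real.Gamma θ := by
  have hu : 0 < α + θ := by linarith [hα.1]
  have hv : 0 < 1 - α := by linarith [hα.2]
  have hmono := monotoneOn_rpow_mul_integral_betaIntegrand hu hv (by linarith)
  have hmem : ∀ s ∈ Ioi (1 : ℝ), (s - 1) / s ∈ Ioc (0 : ℝ) 1 := by
    intro s hs
    have hs : 1 < s := hs
    exact ⟨div_pos (by linarith) (by linarith), (div_le_one (by linarith)).2 (by linarith)⟩
  have hone : θ * ((1 : ℝ) ^ (1 - α - 1) *
      ∫ x in (0 : ℝ)..1, x ^ (α + θ - 1) * (1 - x) ^ (1 - α - 1)) =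
        Real.Gamma (1 - α) * Real.Gamma (α + θ) / Real.Gamma θ := by
    rw [one_rpow, one_mul, integral_betaIntegrand hu hv,
      show α + θ + (1 - α) = θ + 1 by ring, Real.Gamma_add_one hθ.ne']
    have := (Real.Gamma_pos_of_pos hθ).ne'
    field_simp
  have hF : MonotoneOn
      (fun s : ℝ => s ^ α * (θ / (s - 1)) *
        ∫ t in Ioi (1 : ℝ), (1 + t / (s - 1)) ^ (-θ - 1) * t ^ (-α)) (Ioi 1) := by
    intro s hs s' hs' hss
    have hs1 : 1 < s := hs
    have hs1' : 1 < s' := hs'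
    simp only [rpow_mul_integral_Ioi_eq_integral_betaIntegrand θ α hs1,
      rpow_mul_integral_Ioi_eq_integral_betaIntegrand θ α hs1']
    refine mul_le_mul_of_nonneg_left (hmono (hmem s hs) (hmem s' hs') ?_) hθ.le
    rw [div_le_div_iff₀ (by linarith) (by linarith)]
    linarith
  have hle : ∀ s ∈ Ioi (1 : ℝ),
      s ^ α * (θ / (s - 1)) *
          (∫ t in Ioi (1 : ℝ), (1 + t / (s - 1)) ^ (-θ - 1) * t ^ (-α)) ≤
        Real.Gamma (1 - α) * Real.Gamma (α + θ) / Real.Gamma θ := by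
    intro s hs
    rw [rpow_mul_integral_Ioi_eq_integral_betaIntegrand θ α hs, ← hone]
    exact mul_le_mul_of_nonneg_left
      (hmono (hmem s hs) (right_mem_Ioc.2 zero_lt_one) (hmem s hs).2) hθ.le
  refine ⟨hF, hle, IsLUB.csSup_eq ⟨?_, ?_⟩ (nonempty_Ioi.image _)⟩
  · rintro _ ⟨s, hs, rfl⟩
    exact hle s hs
  · intro b hb
    have hcont : ContinuousWithinAt (fun a : ℝ => θ * (a ^ (1 - α - 1) *
        ∫ x in (0 : ℝ)..a, x ^ (α + θ - 1) * (1 - x) ^ (1 - α - 1))) (Icc 0 1) 1 := by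
      have h := intervalIntegral.continuousOn_primitive_interval'
        (intervalIntegrable_betaIntegrand hu hv) left_mem_uIcc
      rw [uIcc_of_le zero_le_one] at h
      exact continuousWithinAt_const.mul
        ((continuousAt_rpow_const 1 _ (Or.inl one_ne_zero)).continuousWithinAt.mul
          (h 1 (right_mem_Icc.2 zero_le_one)))
    have hlim : Filter.Tendsto (fun s : ℝ => (s - 1) / s) Filter.atTop (nhdsWithin 1 (Icc 0 1)) := by
      refine tendsto_nhdsWithin_iff.2 ⟨?_, ?_⟩
      · have h : Filter.Tendsto (fun s : ℝ => 1 - s⁻¹) Filter.atTop (nhds 1) := by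
          simpa using tendsto_inv_atTop_zero.const_sub (1 : ℝ)
        refine h.congr' ?_
        filter_upwards [Filter.eventually_ne_atTop 0] with s hs
        field_simp
      · filter_upwards [Filter.eventually_gt_atTop 1] with s hs
        exact Ioc_subset_Icc_self (hmem s hs)
    rw [← hone]
    refine le_of_tendsto (hcont.tendsto.comp hlim) ?_
    filter_upwards [Filter.eventually_gt_atTop 1] with s hs
    refine le_of_eq_of_le ?_ (hb ⟨s, hs, rfl⟩)
    exact (rpow_mul_integral_Ioi_eq_integral_betaIntegrand θ α hs).symm
end

section
/- If θ ∈ (0,1) and α ∈ (0, 1−θ), then Γ(1−α)Γ(α+θ) < Γ(θ); i.e., the Lipschitz constant c(α,θ) = Γ(1−α)Γ(α+θ)/Γ(θ) is strictly less than 1. -/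
open Real Set

/-- Log-convexity of `Γ` on `(0, ∞)`, in product form. -/
theorem Gamma_mul_Gamma_le_of_convex_combination {s t a b : ℝ} (hs : 0 < s) (ht : 0 < t)
    (ha : 0 < a) (hb : 0 < b) (hab : a + b = 1) :
    Real.Gamma (a * s + b * t) * Real.Gamma (b * s + a * t) ≤ Real.Gamma s * Real.Gamma t := by
  have h₁ := Real.Gamma_mul_add_mul_le_rpow_Gamma_mul_rpow_Gamma hs ht ha hb hab
  have h₂ := Real.Gamma_mul_add_mul_le_rpow_Gamma_mul_rpow_Gamma hs ht hb ha
    (by rw [add_comm, hab])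
  have hΓs := Real.Gamma_pos_of_pos hs
  have hΓt := Real.Gamma_pos_of_pos ht
  calc Real.Gamma (a * s + b * t) * Real.Gamma (b * s + a * t)
      ≤ (Real.Gamma s ^ a * Real.Gamma t ^ b) * (Real.Gamma s ^ b * Real.Gamma t ^ a) :=
        mul_le_mul h₁ h₂ (Real.Gamma_pos_of_pos (by positivity)).le (by positivity)
    _ = (Real.Gamma s ^ a * Real.Gamma s ^ b) * (Real.Gamma t ^ a * Real.Gamma t ^ b) := by ring
    _ = Real.Gamma s * Real.Gamma t := by
        rw [← Real.rpow_add hΓs, ← Real.rpow_add hΓt, hab, Real.rpow_one, Real.rpow_one]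

/-- If `θ ∈ (0,1)` and `α ∈ (0, 1−θ)`, then
`Γ(1−α)Γ(α+θ) < Γ(θ)`, i.e. `c(α,θ) = Γ(1−α)Γ(α+θ)/Γ(θ) < 1`. -/
theorem c_lt_one_subcritical (θ α : ℝ) (hθ : θ ∈ Ioo (0 : ℝ) 1)
    (hα : α ∈ Ioo (0 : ℝ) (1 - θ)) :
    Real.Gamma (1 - α) * Real.Gamma (α + θ) < Real.Gamma θ ∧
      Real.Gamma (1 - α) * Real.Gamma (α + θ) / Real.Gamma θ < 1 := by
  obtain ⟨hθ₀, hθ₁⟩ := hθ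
  obtain ⟨hα₀, hα₁⟩ := hα
  have hd : 0 < 1 - θ := by linarith
  have hΓθ := Real.Gamma_pos_of_pos hθ₀
  -- Shift all arguments by one: log-convexity on `[θ + 1, 2]` is enough, because
  -- `(1 - α) * (α + θ) > θ`.
  have hconv : Real.Gamma (1 - α + 1) * Real.Gamma (α + θ + 1) ≤ Real.Gamma (θ + 1) := by
    have h := Gamma_mul_Gamma_le_of_convex_combination (s := θ + 1) (t := 2)
      (a := α / (1 - θ)) (b := (1 - θ - α) / (1 - θ)) (by linarith) two_pos
      (div_pos hα₀ hd) (div_pos (by linarith) hd) (by field_simp; ring)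
    rw [Real.Gamma_two, mul_one] at h
    convert h using 3 <;> field_simp <;> ring
  rw [Real.Gamma_add_one (by linarith), Real.Gamma_add_one (by linarith),
    Real.Gamma_add_one hθ₀.ne'] at hconv
  have hprod : θ < (1 - α) * (α + θ) := by nlinarith
  have hlt : Real.Gamma (1 - α) * Real.Gamma (α + θ) < Real.Gamma θ := by
    have hpos : 0 < Real.Gamma (1 - α) * Real.Gamma (α + θ) :=
      mul_pos (Real.Gamma_pos_of_pos (by linarith)) (Real.Gamma_pos_of_pos (by linarith))
    have := mul_lt_mul_of_pos_right hprod hpos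
    exact lt_of_mul_lt_mul_left (by linarith) hθ₀.le
  exact ⟨hlt, (div_lt_one hΓθ).2 hlt⟩
end

section
/- If θ > 1 and α ∈ (1−θ, 0), then Γ(1−α)Γ(α+θ) < Γ(θ); i.e., the Lipschitz constant c(α,θ) = Γ(1−α)Γ(α+θ)/Γ(θ) is strictly less than 1. -/
open Real Set

/-- Log-convexity of `Γ` applied to two points with the same sum as two outer points. -/
theorem Gamma_add_mul_Gamma_add_le {s a b : ℝ} (hs : 0 < s) (ha : 0 < a) (hb : 0 < b) :
    Real.Gamma (s + a) * Real.Gamma (s + b) ≤ Real.Gamma s * Real.Gamma (s + a + b) := by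
  have hab : 0 < a + b := add_pos ha hb
  have ht : 0 < s + a + b := by positivity
  have hsum : a / (a + b) + b / (a + b) = 1 := by field_simp
  have h₁ := Gamma_mul_add_mul_le_rpow_Gamma_mul_rpow_Gamma hs ht
    (div_pos hb hab) (div_pos ha hab) (by rw [add_comm, hsum])
  have h₂ := Gamma_mul_add_mul_le_rpow_Gamma_mul_rpow_Gamma hs ht
    (div_pos ha hab) (div_pos hb hab) hsum
  have e₁ : b / (a + b) * s + a / (a + b) * (s + a + b) = s + a := by field_simp; ring
  have e₂ : a / (a + b) * s + b / (a + b) * (s + a + b) = s + b := by field_simp; ring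
  rw [e₁] at h₁
  rw [e₂] at h₂
  have hΓs := Gamma_pos_of_pos hs
  have hΓt := Gamma_pos_of_pos ht
  calc Real.Gamma (s + a) * Real.Gamma (s + b)
      ≤ _ := mul_le_mul h₁ h₂ (Gamma_pos_of_pos (by positivity)).le (by positivity)
    _ = Real.Gamma s ^ (a / (a + b) + b / (a + b)) *
          Real.Gamma (s + a + b) ^ (a / (a + b) + b / (a + b)) := by
        rw [rpow_add hΓs, rpow_add hΓt]; ring
    _ = Real.Gamma s * Real.Gamma (s + a + b) := by rw [hsum, rpow_one, rpow_one]

theorem Gamma_one_add_mul_Gamma_one_add_lt {a b : ℝ} (ha : 0 < a) (hb : 0 < b) :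
    Real.Gamma (1 + a) * Real.Gamma (1 + b) < Real.Gamma (1 + a + b) := by
  have h := Gamma_add_mul_Gamma_add_le two_pos ha hb
  rw [show 2 + a = (1 + a) + 1 by ring, show 2 + b = (1 + b) + 1 by ring,
    show 1 + a + 1 + b = (1 + a + b) + 1 by ring, Gamma_two, one_mul,
    Gamma_add_one (by positivity), Gamma_add_one (by positivity),
    Gamma_add_one (by positivity)] at h
  have hp : 0 < Real.Gamma (1 + a) * Real.Gamma (1 + b) :=
    mul_pos (Gamma_pos_of_pos (by positivity)) (Gamma_pos_of_pos (by positivity))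
  have hc : 0 < 1 + a + b := by positivity
  refine lt_of_mul_lt_mul_left ?_ hc.le
  nlinarith [mul_pos (mul_pos ha hb) hp]

/-- If `θ > 1` and `α ∈ (1−θ, 0)`, then
`Γ(1−α)Γ(α+θ) < Γ(θ)`, i.e. `c(α,θ) = Γ(1−α)Γ(α+θ)/Γ(θ) < 1`. -/
theorem c_lt_one_supercritical (θ α : ℝ) (hθ : 1 < θ)
    (hα : α ∈ Ioo (1 - θ) (0 : ℝ)) :
    Real.Gamma (1 - α) * Real.Gamma (α + θ) < Real.Gamma θ ∧
      Real.Gamma (1 - α) * Real.Gamma (α + θ) / Real.Gamma θ < 1 := by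
  have h := Gamma_one_add_mul_Gamma_one_add_lt (a := -α) (b := α + θ - 1)
    (by linarith [hα.2]) (by linarith [hα.1])
  rw [show 1 + -α = 1 - α by ring, show 1 + (α + θ - 1) = α + θ by ring,
    show 1 - α + (α + θ - 1) = θ by ring] at h
  exact ⟨h, (div_lt_one (Gamma_pos_of_pos (by linarith))).2 h⟩
end

section
/- Let θ ∈ (0,1) and define f_Bes(s) = (sin(πθ)/π) ∫_{s−1}^∞ t^{θ−1} (t+1)^{−1} dt for s ≥ 1. Then f_Bes satisfies the integral equation T(f_Bes) = f_Bes, i.e., for all s ≥ 1: f_Bes(s) = 1 − (1 − 1/s)^θ + θ(s−1)^θ ∫_1^∞ (s + t − 1)^{−θ−1} f_Bes(t) dt. -/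
open MeasureTheory Real Set

/-- The Bessel function `f_Bes(s) = (sin(πθ)/π) ∫_{s−1}^∞ t^{θ−1}(t+1)^{−1} dt`. -/
noncomputable def fBes (θ : ℝ) : ℝ → ℝ :=
  fun s => Real.sin (π * θ) / π * ∫ t in Ioi (s - 1), t ^ (θ - 1) * (t + 1)⁻¹

/-- The substitution `v = a u / (b + u)` maps `(0, ∞)` onto `(0, a)`. -/
theorem setIntegral_Ioo_eq_setIntegral_Ioi_mobius {a b : ℝ} (ha : 0 < a) (hb : 0 < b)
    (g : ℝ → ℝ) :
    ∫ v in Ioo 0 a, g v = ∫ u in Ioi (0 : ℝ), a * b / (b + u) ^ 2 * g (a * u / (b + u)) := by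
  have himage : (fun u : ℝ => a * u / (b + u)) '' Ioi 0 = Ioo 0 a := by
    ext v
    constructor
    · rintro ⟨u, hu, rfl⟩
      have hu : 0 < u := hu
      refine ⟨by positivity, ?_⟩
      rw [div_lt_iff₀ (by positivity)]
      nlinarith [mul_pos ha hb]
    · rintro ⟨hv, hva⟩
      have h : 0 < a - v := sub_pos.2 hva
      refine ⟨b * v / (a - v), show 0 < b * v / (a - v) by positivity, ?_⟩
      have h' : b + b * v / (a - v) ≠ 0 := by positivity
      dsimp only
      rw [div_eq_iff h']
      field_simp
      ring
  have hderiv : ∀ u ∈ Ioi (0 : ℝ),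
      HasDerivWithinAt (fun u : ℝ => a * u / (b + u)) (a * b / (b + u) ^ 2) (Ioi 0) u := by
    intro u hu
    have hu : 0 < u := hu
    have h := (((hasDerivAt_id u).const_mul a).div ((hasDerivAt_id u).const_add b)
      (by simp only [id]; positivity)).hasDerivWithinAt (s := Ioi 0)
    convert! h using 1
    simp only [id]
    ring
  have hinj : InjOn (fun u : ℝ => a * u / (b + u)) (Ioi 0) := by
    intro u hu w hw h
    have hu : 0 < u := hu
    have hw : 0 < w := hw
    dsimp only at h
    rw [div_eq_div_iff (by positivity) (by positivity)] at h
    have h' : a * b * (u - w) = 0 := by linarith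
    rcases mul_eq_zero.1 h' with h' | h'
    · exact absurd h' (by positivity)
    · linarith
  rw [← himage, integral_image_eq_integral_abs_deriv_smul measurableSet_Ioi hderiv hinj]
  refine setIntegral_congr_fun measurableSet_Ioi fun u hu => ?_
  have hu : 0 < u := hu
  rw [abs_of_pos (by positivity), smul_eq_mul]

theorem setIntegral_Ioo_rpow_mul_one_sub_rpow {θ : ℝ} (hθ : θ ∈ Ioo (0 : ℝ) 1) :
    ∫ v in Ioo (0 : ℝ) 1, v ^ (θ - 1) * (1 - v) ^ (-θ) = π / sin (π * θ) := by
  rw [← Gamma_mul_Gamma_one_sub]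
  have hbeta := ProbabilityTheory.beta_eq_betaIntegralReal θ (1 - θ) hθ.1 (sub_pos.2 hθ.2)
  rw [ProbabilityTheory.beta, add_sub_cancel, Gamma_one, div_one] at hbeta
  rw [hbeta, Complex.betaIntegral, ← integral_Ioc_eq_integral_Ioo,
    ← intervalIntegral.integral_of_le zero_le_one, ← Complex.ofReal_re (intervalIntegral _ _ _ _),
    ← intervalIntegral.integral_ofReal]
  congr 1
  refine intervalIntegral.integral_congr fun v hv => ?_
  rw [uIcc_of_le zero_le_one] at hv
  rw [Complex.ofReal_mul, Complex.ofReal_cpow hv.1, Complex.ofReal_cpow (sub_nonneg.2 hv.2)]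
  push_cast
  ring_nf

theorem setIntegral_Ioi_rpow_mul_add_one_inv {θ : ℝ} (hθ : θ ∈ Ioo (0 : ℝ) 1) :
    ∫ u in Ioi (0 : ℝ), u ^ (θ - 1) * (u + 1)⁻¹ = π / sin (π * θ) := by
  rw [← setIntegral_Ioo_rpow_mul_one_sub_rpow hθ,
    setIntegral_Ioo_eq_setIntegral_Ioi_mobius one_pos one_pos]
  refine setIntegral_congr_fun measurableSet_Ioi fun u hu => ?_
  have hu : 0 < u := hu
  have hu1 : 0 < 1 + u := by positivity
  have h : 1 - 1 * u / (1 + u) = (1 + u)⁻¹ := by field_simp; ring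
  rw [h, one_mul u, div_rpow hu.le hu1.le, inv_rpow hu1.le, rpow_neg hu1.le, inv_inv,
    rpow_sub_one hu1.ne', add_comm u 1]
  have := (rpow_pos_of_pos hu1 θ).ne'
  field_simp

theorem sin_pi_mul_pos {θ : ℝ} (hθ : θ ∈ Ioo (0 : ℝ) 1) : 0 < sin (π * θ) :=
  sin_pos_of_pos_of_lt_pi (mul_pos pi_pos hθ.1) (by nlinarith [pi_pos, hθ.2])

theorem integrableOn_Ioi_rpow_mul_add_one_inv {θ : ℝ} (hθ : θ ∈ Ioo (0 : ℝ) 1) :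
    IntegrableOn (fun u : ℝ => u ^ (θ - 1) * (u + 1)⁻¹) (Ioi 0) := by
  by_contra h
  have h0 := setIntegral_Ioi_rpow_mul_add_one_inv hθ
  rw [integral_undef h] at h0
  exact (div_pos pi_pos (sin_pi_mul_pos hθ)).ne h0

theorem fBes_one {θ : ℝ} (hθ : θ ∈ Ioo (0 : ℝ) 1) : fBes θ 1 = 1 := by
  have := (sin_pi_mul_pos hθ).ne'
  rw [fBes, sub_self, setIntegral_Ioi_rpow_mul_add_one_inv hθ]
  field_simp

theorem fBes_eq_one_sub {θ s : ℝ} (hθ : θ ∈ Ioo (0 : ℝ) 1) (hs : 1 < s) :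
    fBes θ s =
      1 - sin (π * θ) / π * ∫ u in Ioo 0 (s - 1), u ^ (θ - 1) * (u + 1)⁻¹ := by
  have hx : 0 < s - 1 := sub_pos.2 hs
  have hInt := integrableOn_Ioi_rpow_mul_add_one_inv hθ
  have h := setIntegral_union (μ := volume) (Ioc_disjoint_Ioi_same (a := (0 : ℝ)) (b := s - 1))
    measurableSet_Ioi (hInt.mono_set Ioc_subset_Ioi_self) (hInt.mono_set (Ioi_subset_Ioi hx.le))
  rw [Ioc_union_Ioi_eq_Ioi hx.le, integral_Ioc_eq_integral_Ioo] at h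
  have h1 := fBes_one hθ
  rw [fBes, sub_self, h] at h1
  rw [fBes]
  linarith

/-- Fubini's theorem on the region `1 < t < u + 1`. -/
theorem setIntegral_Ioi_mul_setIntegral_Ioi_sub_one {k h : ℝ → ℝ}
    (hk : IntegrableOn k (Ioi 1)) (hh : IntegrableOn h (Ioi 0)) :
    ∫ t in Ioi (1 : ℝ), k t * ∫ u in Ioi (t - 1), h u =
      ∫ u in Ioi (0 : ℝ), h u * ∫ t in Ioo 1 (u + 1), k t := by
  have hmeas : MeasurableSet {p : ℝ × ℝ | p.1 - 1 < p.2} :=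
    measurableSet_lt (by fun_prop) (by fun_prop)
  have hInt := (hk.integrable.mul_prod hh.integrable).indicator hmeas
  have hswap := integral_integral_swap (f := fun t u =>
    {p : ℝ × ℝ | p.1 - 1 < p.2}.indicator (fun p => k p.1 * h p.2) (t, u)) hInt
  convert! hswap using 1
  · refine setIntegral_congr_fun measurableSet_Ioi fun t ht => ?_
    have ht : 1 < t := ht
    have hset : Ioi (0 : ℝ) ∩ Ioi (t - 1) = Ioi (t - 1) :=
      inter_eq_right.2 (Ioi_subset_Ioi (by linarith))
    rw [← integral_const_mul, ← hset, ← setIntegral_indicator measurableSet_Ioi]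
    rfl
  · refine setIntegral_congr_fun measurableSet_Ioi fun u hu => ?_
    have hset : Ioi (1 : ℝ) ∩ Iio (u + 1) = Ioo 1 (u + 1) := rfl
    rw [← integral_const_mul, ← hset, ← setIntegral_indicator measurableSet_Iio]
    refine setIntegral_congr_fun measurableSet_Ioi fun t _ => ?_
    simp only [indicator, mem_Iio, mem_ofPred_eq, sub_lt_iff_lt_add, mul_comm]

theorem mul_setIntegral_Ioo_add_sub_one_rpow {θ s u : ℝ} (hs : 0 < s) (hu : 0 < u) :
    θ * ∫ t in Ioo 1 (u + 1), (s + t - 1) ^ (-θ - 1) = s ^ (-θ) - (s + u) ^ (-θ) := by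
  have hderiv : ∀ t ∈ uIcc 1 (u + 1),
      HasDerivAt (fun t : ℝ => -(s + t - 1) ^ (-θ)) (θ * (s + t - 1) ^ (-θ - 1)) t := by
    intro t ht
    rw [uIcc_of_le (by linarith)] at ht
    have h := ((((hasDerivAt_id t).const_add s).sub_const 1).rpow_const (p := -θ)
      (Or.inl (show s + t - 1 ≠ 0 by linarith [ht.1]))).neg
    convert! h using 1
    simp only [id]
    ring
  have hcont : ContinuousOn (fun t : ℝ => θ * (s + t - 1) ^ (-θ - 1)) (uIcc 1 (u + 1)) := by
    refine continuousOn_const.mul (ContinuousOn.rpow_const (by fun_prop) fun t ht => Or.inl ?_)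
    rw [uIcc_of_le (by linarith)] at ht
    linarith [ht.1]
  rw [← integral_const_mul, ← integral_Ioc_eq_integral_Ioo,
    ← intervalIntegral.integral_of_le (by linarith),
    intervalIntegral.integral_eq_sub_of_hasDerivAt hderiv hcont.intervalIntegrable]
  ring_nf

theorem setIntegral_Ioo_rpow_mul_add_one_inv {θ s : ℝ} (hs : 1 < s) :
    ∫ v in Ioo 0 (s - 1), v ^ (θ - 1) * (v + 1)⁻¹ =
      (s - 1) ^ θ * ∫ u in Ioi (0 : ℝ), u ^ (θ - 1) * (u + 1)⁻¹ * (s + u) ^ (-θ) := by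
  have hx : 0 < s - 1 := sub_pos.2 hs
  have hs0 : 0 < s := by linarith
  rw [setIntegral_Ioo_eq_setIntegral_Ioi_mobius hx hs0, ← integral_const_mul]
  refine setIntegral_congr_fun measurableSet_Ioi fun u hu => ?_
  have hu : 0 < u := hu
  have hsu : 0 < s + u := by positivity
  have h : (s - 1) * u / (s + u) + 1 = s * (u + 1) / (s + u) := by field_simp; ring
  rw [h, div_rpow (by positivity) hsu.le, mul_rpow hx.le hu.le, rpow_neg hsu.le,
    rpow_sub_one hsu.ne', rpow_sub_one hx.ne']
  have := (rpow_pos_of_pos hsu θ).ne'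
  field_simp

/-- For `θ ∈ (0,1)`, the function `f_Bes` satisfies the integral
equation `T f_Bes = f_Bes` on `[1,∞)`. -/
theorem fBes_fixed_point (θ : ℝ) (hθ : θ ∈ Ioo (0 : ℝ) 1) :
    ∀ s, 1 ≤ s → T θ (fBes θ) s = fBes θ s := by
  intro s hs
  rcases hs.eq_or_lt with rfl | hs
  · simp [T, fBes_one hθ, zero_rpow hθ.1.ne']
  have hs0 : 0 < s := by linarith
  have hx : 0 < s - 1 := sub_pos.2 hs
  have hInt := integrableOn_Ioi_rpow_mul_add_one_inv hθ
  have hk : IntegrableOn (fun t : ℝ => (s + t - 1) ^ (-θ - 1)) (Ioi 1) := by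
    refine (integrableOn_add_rpow_Ioi_of_lt (a := -θ - 1) (m := s - 1) (c := 1)
      (by linarith [hθ.1]) (by linarith)).congr_fun (fun t _ => ?_) measurableSet_Ioi
    dsimp only
    ring_nf
  have hInt' : IntegrableOn
      (fun u : ℝ => u ^ (θ - 1) * (u + 1)⁻¹ * (s + u) ^ (-θ)) (Ioi 0) := by
    refine (hInt.mul_const (s ^ (-θ))).mono' (by fun_prop) ?_
    filter_upwards [ae_restrict_mem measurableSet_Ioi] with u hu
    have hu : 0 < u := hu
    rw [norm_of_nonneg (by positivity)]
    gcongr ?_ * ?_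
    exact rpow_le_rpow_of_nonpos hs0 (by linarith) (by linarith [hθ.1])
  have hfubini : θ * ∫ t in Ioi (1 : ℝ), (s + t - 1) ^ (-θ - 1) * fBes θ t =
      s ^ (-θ) - sin (π * θ) / π *
        ∫ u in Ioi (0 : ℝ), u ^ (θ - 1) * (u + 1)⁻¹ * (s + u) ^ (-θ) := by
    have hone := fBes_one hθ
    rw [fBes, sub_self] at hone
    calc
      _ = sin (π * θ) / π * (θ * ∫ t in Ioi (1 : ℝ), (s + t - 1) ^ (-θ - 1) *
            ∫ u in Ioi (t - 1), u ^ (θ - 1) * (u + 1)⁻¹) := by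
        rw [mul_left_comm, ← integral_const_mul (sin (π * θ) / π)]
        simp only [fBes, mul_left_comm]
      _ = sin (π * θ) / π * ∫ u in Ioi (0 : ℝ), (u ^ (θ - 1) * (u + 1)⁻¹ * s ^ (-θ) -
            u ^ (θ - 1) * (u + 1)⁻¹ * (s + u) ^ (-θ)) := by
        rw [setIntegral_Ioi_mul_setIntegral_Ioi_sub_one hk hInt, ← integral_const_mul]
        congr 1
        refine setIntegral_congr_fun measurableSet_Ioi fun u hu => ?_
        rw [mul_left_comm, mul_setIntegral_Ioo_add_sub_one_rpow hs0 hu, mul_sub]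
      _ = _ := by
        rw [integral_sub (hInt.mul_const _) hInt', integral_mul_const, mul_sub, ← mul_assoc, hone,
          one_mul]
  have hratio : (1 - 1 / s) ^ θ = (s - 1) ^ θ * s ^ (-θ) := by
    rw [one_sub_div hs0.ne', div_rpow hx.le hs0.le, rpow_neg hs0.le, div_eq_mul_inv]
  rw [fBes_eq_one_sub hθ hs, setIntegral_Ioo_rpow_mul_add_one_inv hs, T, hratio,
    mul_comm θ ((s - 1) ^ θ), mul_assoc ((s - 1) ^ θ) θ, hfubini]
  ring
end
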